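/- Let I ⊆ J be homogeneous ideals of R = K[x_0,...,x_n] with I perfect, J unmixed, codim J = codim I + 1, and let A be a form with I : A = I. Then the ideal I + A·J is unmixed. -/

import Mathlib

open MvPolynomial

/-- A monomial ideal: an ideal generated by monomials. -/
def IsMonomialIdeal {K : Type} [Field K] {m : ℕ} (J : Ideal (MvPolynomial (Fin m) K)) : Prop :=
  ∃ G : Set (Fin m →₀ ℕ), J = Ideal.span ((fun d => (monomial d (1 : K))) '' G)

/-- `d` is the exponent vector of a minimal monomial generator of the monomial ideal `J`. -/
def IsMinGen {K : Type} [Field K] {m : ℕ} (J : Ideal (MvPolynomial (Fin m) K))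
    (d : Fin m →₀ ℕ) : Prop :=
  (monomial d (1 : K)) ∈ J ∧
    ∀ i : Fin m, 0 < d i → (monomial (d - Finsupp.single i 1) (1 : K)) ∉ J

/-- Borel-fixed monomial ideal: stable under the moves `m ↦ (x_j/x_i)·m` for `j < i`. -/
def IsBorelFixed {K : Type} [Field K] {m : ℕ} (J : Ideal (MvPolynomial (Fin m) K)) : Prop :=
  IsMonomialIdeal J ∧
    ∀ d : Fin m →₀ ℕ, (monomial d (1 : K)) ∈ J → ∀ i j : Fin m, j < i → 0 < d i →
      (monomial (d - Finsupp.single i 1 + Finsupp.single j 1) (1 : K)) ∈ J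

/-- The inclusion `K[x_2,...,x_{n+1}] → K[x_1,...,x_{n+1}]` (variable index 0 is `x_1`). -/
noncomputable def varShift (K : Type) [Field K] (n : ℕ) :
    MvPolynomial (Fin n) K →ₐ[K] MvPolynomial (Fin (n + 1)) K :=
  rename Fin.succ

/-- `I_j = (J : x_1^j) ∩ K[x_2,...,x_{n+1}]`, an ideal of `T = K[x_2,...,x_{n+1}]`. -/
noncomputable def sliceIdeal {K : Type} [Field K] {n : ℕ}
    (J : Ideal (MvPolynomial (Fin (n + 1)) K)) (j : ℕ) : Ideal (MvPolynomial (Fin n) K) :=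
  Ideal.comap (varShift K n) (J.colon (Ideal.span {(X 0 : MvPolynomial (Fin (n + 1)) K) ^ j}))

/-- The Hilbert function of `S/J`: the `K`-dimension of the degree `s` part. -/
noncomputable def hilb {K : Type} [Field K] {m : ℕ}
    (J : Ideal (MvPolynomial (Fin m) K)) (s : ℕ) : ℕ :=
  Module.finrank K (homogeneousSubmodule (Fin m) K s) -
    Module.finrank K
      (homogeneousSubmodule (Fin m) K s ⊓ Submodule.restrictScalars K J :
        Submodule K (MvPolynomial (Fin m) K))

/-- A homogeneous ideal (with respect to total degree). -/
def IsHomogeneousIdeal {K : Type} [Field K] {m : ℕ}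
    (I : Ideal (MvPolynomial (Fin m) K)) : Prop :=
  ∀ p ∈ I, ∀ k : ℕ, (homogeneousComponent k p) ∈ I

/-- `α` is the initial degree of `J`: the least degree of a nonzero (homogeneous) element. -/
def IsInitialDegree {K : Type} [Field K] {m : ℕ}
    (J : Ideal (MvPolynomial (Fin m) K)) (α : ℕ) : Prop :=
  IsLeast {k : ℕ | ∃ p ∈ J, p ≠ 0 ∧ MvPolynomial.IsHomogeneous p k} α

/-- The height (codimension) of an ideal: the infimum of heights of primes containing it. -/
noncomputable def idealHeight {R : Type} [CommRing R] (I : Ideal R) : ℕ∞ :=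
  ⨅ (P : PrimeSpectrum R) (_ : I ≤ P.asIdeal), Order.height P

/-- `S/J` is Cohen-Macaulay: there is a regular sequence inside the irrelevant maximal
ideal of length equal to the Krull dimension of `S/J`. -/
def IsCMQuotient {K : Type} [Field K] {m : ℕ} (J : Ideal (MvPolynomial (Fin m) K)) : Prop :=
  ∃ rs : List (MvPolynomial (Fin m) K),
    (∀ f ∈ rs, f ∈ Ideal.span (Set.range (X : Fin m → MvPolynomial (Fin m) K))) ∧
    RingTheory.Sequence.IsRegular (MvPolynomial (Fin m) K ⧸ J) rs ∧
    (rs.length : WithBot ℕ∞) = ringKrullDim (MvPolynomial (Fin m) K ⧸ J)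

/-- An unmixed ideal: all associated primes of `R/I` have the same height, namely that of `I`. -/
def IsUnmixed {K : Type} [Field K] {m : ℕ} (I : Ideal (MvPolynomial (Fin m) K)) : Prop :=
  ∀ P ∈ associatedPrimes (MvPolynomial (Fin m) K) (MvPolynomial (Fin m) K ⧸ I),
    idealHeight P = idealHeight I

/-- Degree-lexicographic order on exponent vectors: `d > e`. -/
def DegLexGT {m : ℕ} (d e : Fin m →₀ ℕ) : Prop :=
  (e.sum fun _ k => k) < (d.sum fun _ k => k) ∨
    ((d.sum fun _ k => k) = (e.sum fun _ k => k) ∧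
      ∃ i : Fin m, (∀ k < i, d k = e k) ∧ e i < d i)

/-- A lex-segment monomial ideal. -/
def IsLexSegment {K : Type} [Field K] {m : ℕ} (J : Ideal (MvPolynomial (Fin m) K)) : Prop :=
  IsMonomialIdeal J ∧
    ∀ d e : Fin m →₀ ℕ, (d.sum fun _ k => k) = (e.sum fun _ k => k) →
      DegLexGT d e → (monomial e (1 : K)) ∈ J → (monomial d (1 : K)) ∈ J

/-- `macaulayBound d a = a^{⟨d⟩}`, the Macaulay upper bound computed from the `d`-th
binomial expansion of `a`. -/
def macaulayBound : ℕ → ℕ → ℕ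
  | _, 0 => 0
  | 0, _ + 1 => 0
  | d + 1, a + 1 =>
    let k := Nat.findGreatest (fun k => Nat.choose k (d + 1) ≤ a + 1) (a + d + 2)
    Nat.choose (k + 1) (d + 2) + macaulayBound d (a + 1 - Nat.choose k (d + 1))

/-- The first difference of a numerical function (with `f(-1) = 0`). -/
def delta (f : ℕ → ℤ) : ℕ → ℤ
  | 0 => f 0
  | n + 1 => f (n + 1) - f n

/-- An O-sequence: `f(0) = 1`, nonnegative, satisfying Macaulay's growth condition. -/
def IsOSequence (f : ℕ → ℤ) : Prop :=
  f 0 = 1 ∧ (∀ t, 0 ≤ f t) ∧ ∀ t, 1 ≤ t → f (t + 1) ≤ (macaulayBound t (f t).toNat : ℤ)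

namespace BDL

/-- `x` is a non-zerodivisor modulo `L`. -/
def Reg {S : Type*} [CommRing S] (L : Ideal S) (x : S) : Prop :=
  ∀ f, x * f ∈ L → f ∈ L

/-- `P` is an associated prime of `S/L`. -/
def AssP {S : Type*} [CommRing S] (L P : Ideal S) : Prop :=
  P.IsPrime ∧ ∃ f, ∀ a, a ∈ P ↔ a * f ∈ L

/-- There is a regular sequence of length `k` on `S/L` in the maximal ideal. -/
def DepthGE {S : Type*} [CommRing S] [IsLocalRing S] : ℕ → Ideal S → Prop
  | 0, L => L ≤ IsLocalRing.maximalIdeal S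
  | k + 1, L => ∃ x ∈ IsLocalRing.maximalIdeal S, Reg L x ∧ DepthGE k (L ⊔ Ideal.span {x})

section General
variable {S : Type*} [CommRing S]

theorem mem_sup_span {L : Ideal S} {x f : S} :
    f ∈ L ⊔ Ideal.span {x} ↔ ∃ l ∈ L, ∃ g, f = l + x * g := by
  rw [Submodule.mem_sup]
  constructor
  · rintro ⟨l, hl, y, hy, rfl⟩
    obtain ⟨g, rfl⟩ := Ideal.mem_span_singleton'.1 hy
    exact ⟨l, hl, g, by ring⟩
  · rintro ⟨l, hl, g, rfl⟩
    exact ⟨l, hl, x * g, Ideal.mul_mem_right _ _ (Ideal.mem_span_singleton_self x), rfl⟩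

theorem AssP.not_mem {L P : Ideal S} (hP : P.IsPrime) {f : S} (h : ∀ a, a ∈ P ↔ a * f ∈ L) :
    f ∉ L := by
  intro hf
  exact hP.ne_top ((Ideal.eq_top_iff_one _).2 ((h 1).2 (by simpa using hf)))

theorem AssP.le {L P : Ideal S} (h : AssP L P) : L ≤ P := by
  obtain ⟨_, f, hf⟩ := h
  intro a ha
  exact (hf a).2 (Ideal.mul_mem_right _ _ ha)

theorem AssP.reg_not_mem {L P : Ideal S} (h : AssP L P) {x : S} (hx : Reg L x) : x ∉ P := by
  obtain ⟨hP, f, hf⟩ := h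
  intro hxP
  exact AssP.not_mem hP hf (hx f ((hf x).1 hxP))

theorem mk_smul_mem {L : Ideal S} (a f : S) :
    a ∈ (⊥ : Submodule S (S ⧸ L)).colon {Ideal.Quotient.mk L f} ↔ a * f ∈ L := by
  rw [Submodule.mem_colon_singleton, Submodule.mem_bot, ← Ideal.Quotient.eq_zero_iff_mem]
  rfl

theorem assP_iff [IsNoetherianRing S] {L P : Ideal S} :
    AssP L P ↔ P ∈ associatedPrimes S (S ⧸ L) := by
  rw [AssociatedPrimes.mem_iff, isAssociatedPrime_iff]
  refine and_congr_right fun _ => ?_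
  constructor
  · rintro ⟨f, hf⟩
    refine ⟨Ideal.Quotient.mk L f, ?_⟩
    ext a
    rw [hf, mk_smul_mem]
  · rintro ⟨y, hy⟩
    obtain ⟨f, rfl⟩ := Ideal.Quotient.mk_surjective y
    refine ⟨f, fun a => ?_⟩
    rw [hy, mk_smul_mem]

theorem exists_assP [IsNoetherianRing S] {L : Ideal S} {f : S} (hf : f ∉ L) :
    ∃ P, AssP L P ∧ ∀ a, a * f ∈ L → a ∈ P := by
  obtain ⟨P, hP, h⟩ := exists_le_isAssociatedPrime_of_isNoetherianRing S
    (Ideal.Quotient.mk L f) (fun h => hf (Ideal.Quotient.eq_zero_iff_mem.1 h))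
  exact ⟨P, assP_iff.2 hP, fun a ha => h ((mk_smul_mem a f).2 ha)⟩

theorem assP_of_minimal [IsNoetherianRing S] {L P : Ideal S} (h : P ∈ L.minimalPrimes) :
    AssP L P := by
  rw [assP_iff]
  apply Module.associatedPrimes.minimalPrimes_annihilator_subset_associatedPrimes S (S ⧸ L)
  rwa [Ideal.annihilator_quotient]

theorem reg_of_forall [IsNoetherianRing S] {L : Ideal S} {x : S} (h : ∀ P, AssP L P → x ∉ P) :
    Reg L x := by
  intro f hf
  by_contra hfL
  obtain ⟨P, hP, h'⟩ := exists_assP hfL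
  exact h P hP (h' x hf)

theorem exists_reg [IsNoetherianRing S] (Q L₁ L₂ : Ideal S) (h₁ : ∀ P, AssP L₁ P → ¬ Q ≤ P)
    (h₂ : ∀ P, AssP L₂ P → ¬ Q ≤ P) : ∃ x ∈ Q, Reg L₁ x ∧ Reg L₂ x := by
  by_contra hcon
  push Not at hcon
  have hfin : (associatedPrimes S (S ⧸ L₁) ∪ associatedPrimes S (S ⧸ L₂)).Finite :=
    (associatedPrimes.finite S _).union (associatedPrimes.finite S _)
  have := (Q.subset_union_prime_finite hfin (f := id) 0 0
    (fun i h _ _ => by rcases h with h | h <;> exact h.isPrime)).1 (by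
      intro x hx
      by_contra hxu
      simp only [Set.mem_iUnion, not_exists] at hxu
      refine hcon x hx (reg_of_forall fun P hP hxP => ?_) (reg_of_forall fun P hP hxP => ?_)
      · exact hxu P (Or.inl (assP_iff.1 hP)) hxP
      · exact hxu P (Or.inr (assP_iff.1 hP)) hxP)
  obtain ⟨P, hP | hP, hQ⟩ := this
  · exact h₁ P (assP_iff.2 hP) hQ
  · exact h₂ P (assP_iff.2 hP) hQ

theorem reg_swap {L : Ideal S} {x z : S} (hx : Reg L x) (hz : Reg (L ⊔ Ideal.span {x}) z) :
    Reg (L ⊔ Ideal.span {z}) x := by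
  intro f hf
  obtain ⟨l, hl, g, e⟩ := mem_sup_span.1 hf
  have hg : g ∈ L ⊔ Ideal.span {x} := hz g (mem_sup_span.2 ⟨-l, L.neg_mem hl, f, by
    linear_combination -e⟩)
  obtain ⟨l', hl', h, rfl⟩ := mem_sup_span.1 hg
  have : f - z * h ∈ L := hx _ (by
    have : x * (f - z * h) = l + z * l' := by linear_combination e
    rw [this]
    exact L.add_mem hl (L.mul_mem_left _ hl'))
  exact mem_sup_span.2 ⟨_, this, h, by ring⟩

/-- Every socle element modulo `x` gives one modulo `y`. -/
theorem socle_swap {L M : Ideal S} {x y z : S} (hx : Reg L x) (hy : Reg L y) (hyM : y ∈ M)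
    (hz : z ∉ L ⊔ Ideal.span {x}) (h : ∀ a ∈ M, a * z ∈ L ⊔ Ideal.span {x}) :
    ∃ w, w ∉ L ⊔ Ideal.span {y} ∧ ∀ a ∈ M, a * w ∈ L ⊔ Ideal.span {y} := by
  obtain ⟨l, hl, w, e⟩ := mem_sup_span.1 (h y hyM)
  refine ⟨w, ?_, ?_⟩
  · intro hw
    obtain ⟨l', hl', w', rfl⟩ := mem_sup_span.1 hw
    apply hz
    have : z - x * w' ∈ L := hy _ (by
      have : y * (z - x * w') = l + x * l' := by linear_combination e
      rw [this]
      exact L.add_mem hl (L.mul_mem_left _ hl'))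
    exact mem_sup_span.2 ⟨_, this, w', by ring⟩
  · intro a ha
    obtain ⟨l₂, hl₂, u, e₂⟩ := mem_sup_span.1 (h a ha)
    have : a * w - y * u ∈ L := hx _ (by
      have : x * (a * w - y * u) = y * l₂ - a * l := by linear_combination y * e₂ - a * e
      rw [this]
      exact L.sub_mem (L.mul_mem_left _ hl₂) (L.mul_mem_left _ hl))
    exact mem_sup_span.2 ⟨_, this, u, by ring⟩

theorem height_succ [IsNoetherianRing S] {L : Ideal S} {x : S} (hx : Reg L x) {i : ℕ∞}
    (hi : ∀ P : PrimeSpectrum S, L ≤ P.asIdeal → i ≤ Order.height P)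
    (P : PrimeSpectrum S) (hP : L ⊔ Ideal.span {x} ≤ P.asIdeal) : i + 1 ≤ Order.height P := by
  obtain ⟨P₀, hP₀, hle⟩ := Ideal.exists_minimalPrimes_le (le_sup_left.trans hP)
  have hp : P₀.IsPrime := hP₀.1.1
  have hlt : (⟨P₀, hp⟩ : PrimeSpectrum S) < P := by
    refine lt_of_le_of_ne hle ?_
    rintro rfl
    exact (assP_of_minimal hP₀).reg_not_mem hx
      (hP (le_sup_right (a := L) (Ideal.mem_span_singleton_self x)))
  exact (add_le_add_left (hi ⟨P₀, hp⟩ hP₀.1.2) 1).trans (Order.height_add_one_le hlt)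

end General

section Loc
variable {S : Type*} [CommRing S] [IsLocalRing S]
open IsLocalRing

theorem DepthGE.le : ∀ {k : ℕ} {L : Ideal S}, DepthGE k L → L ≤ maximalIdeal S
  | 0, _, h => h
  | _ + 1, _, ⟨_, _, _, h⟩ => le_sup_left.trans h.le

theorem exists_assP_gt [IsNoetherianRing S] {L P : Ideal S} {x : S} (hP : AssP L P)
    (hx : Reg L x) (hxm : x ∈ maximalIdeal S) :
    ∃ Q, AssP (L ⊔ Ideal.span {x}) Q ∧ P < Q := by
  obtain ⟨f, hf⟩ := hP.2
  let N : Ideal S :=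
    { carrier := {g | ∀ a ∈ P, a * g ∈ L}
      add_mem' := fun {g h} hg hh a ha => by
        rw [mul_add]; exact L.add_mem (hg a ha) (hh a ha)
      zero_mem' := fun a _ => by simp
      smul_mem' := fun c g hg a ha => by
        have : a * (c • g) = c * (a * g) := by simp only [smul_eq_mul]; ring
        rw [this]; exact L.mul_mem_left _ (hg a ha) }
  have hN : ∀ g, g ∈ N ↔ ∀ a ∈ P, a * g ∈ L := fun g => Iff.rfl
  have hNx : ¬ N ≤ L ⊔ Ideal.span {x} := by
    intro hle
    have : N ≤ L := by
      apply Submodule.le_of_le_smul_of_le_jacobson_bot (I := maximalIdeal S)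
        (IsNoetherian.noetherian N) (by rw [jacobson_eq_maximalIdeal _ bot_ne_top])
      intro g hg
      obtain ⟨l, hl, h, rfl⟩ := mem_sup_span.1 (hle hg)
      refine Submodule.add_mem_sup hl (Submodule.smul_mem_smul hxm ?_)
      intro a ha
      apply hx
      have e : x * (a * h) = a * (l + x * h) - a * l := by ring
      rw [e]
      exact L.sub_mem (hg a ha) (L.mul_mem_left _ hl)
    exact AssP.not_mem hP.1 hf (this (fun a ha => (hf a).1 ha))
  obtain ⟨g, hg, hgx⟩ := Set.not_subset.1 hNx
  obtain ⟨Q, hQ, h⟩ := exists_assP hgx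
  refine ⟨Q, hQ, lt_of_le_of_ne (fun a ha => h a (le_sup_left (a := L) (hg a ha))) ?_⟩
  rintro rfl
  exact hP.reg_not_mem hx (hQ.le (le_sup_right (a := L) (Ideal.mem_span_singleton_self x)))

theorem depth_le_coheight [IsNoetherianRing S] : ∀ {k : ℕ} {L P : Ideal S} (_ : DepthGE k L)
    (hP : AssP L P), (k : ℕ∞) ≤ Order.coheight (⟨P, hP.1⟩ : PrimeSpectrum S)
  | 0, _, _, _, _ => by simp
  | k + 1, L, P, ⟨x, hxm, hx, h⟩, hP => by
    obtain ⟨Q, hQ, hlt⟩ := exists_assP_gt hP hx hxm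
    have h1 := depth_le_coheight h hQ
    have hlt' : (⟨P, hP.1⟩ : PrimeSpectrum S) < ⟨Q, hQ.1⟩ := hlt
    push_cast
    exact (add_le_add_left h1 1).trans (Order.coheight_add_one_le hlt')

theorem exchange [IsNoetherianRing S] : ∀ {k : ℕ} {L : Ideal S} {y : S} (_ : DepthGE (k + 1) L)
    (_ : y ∈ maximalIdeal S) (_ : Reg L y), DepthGE k (L ⊔ Ideal.span {y})
  | 0, L, y, h, hy, _ => by
    show L ⊔ Ideal.span {y} ≤ maximalIdeal S
    exact sup_le h.le ((Ideal.span_singleton_le_iff_mem _).2 hy)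
  | k + 1, L, y, ⟨x, hxm, hx, h⟩, hym, hy => by
    have hns : ∀ P, AssP (L ⊔ Ideal.span {x}) P → ¬ maximalIdeal S ≤ P := by
      intro P hP hle
      obtain ⟨x', hx'm, hx', _⟩ := h
      exact hP.reg_not_mem hx' (hle hx'm)
    have hns' : ∀ P, AssP (L ⊔ Ideal.span {y}) P → ¬ maximalIdeal S ≤ P := by
      intro P hP hle
      obtain ⟨f, hf⟩ := hP.2
      obtain ⟨w, hw, hw'⟩ := socle_swap hy hx hxm (AssP.not_mem hP.1 hf)
        (fun a ha => (hf a).1 (hle ha))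
      obtain ⟨Q, hQ, hQ'⟩ := exists_assP hw
      exact hns Q hQ (fun a ha => hQ' a (hw' a ha))
    obtain ⟨z, hzm, hzx, hzy⟩ := exists_reg _ _ _ hns hns'
    have h1 : DepthGE k ((L ⊔ Ideal.span {x}) ⊔ Ideal.span {z}) := exchange h hzm hzx
    have h2 : DepthGE (k + 1) (L ⊔ Ideal.span {z}) :=
      ⟨x, hxm, reg_swap hx hzx, by rwa [sup_right_comm]⟩
    have h3 := exchange h2 hym (reg_swap hy hzy)
    exact ⟨z, hzm, hzy, by rwa [sup_right_comm]⟩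

theorem le_height_add_coheight [IsNoetherianRing S] (Q : PrimeSpectrum S) :
    ∀ {k : ℕ} {L : Ideal S} {i : ℕ∞} (_ : DepthGE k L)
    (_ : ∀ P : PrimeSpectrum S, L ≤ P.asIdeal → i ≤ Order.height P)
    (_ : L ≤ Q.asIdeal), i + k ≤ Order.height Q + Order.coheight Q
  | 0, L, i, _, hi, hQ => by
    simpa using (hi Q hQ).trans le_self_add
  | k + 1, L, i, h, hi, hQ => by
    by_cases hc : ∃ P, AssP L P ∧ Q.asIdeal ≤ P
    · obtain ⟨P, hP, hle⟩ := hc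
      refine add_le_add (hi Q hQ) ((depth_le_coheight h hP).trans ?_)
      exact Order.coheight_anti (show Q ≤ ⟨P, hP.1⟩ from hle)
    · push Not at hc
      obtain ⟨x, hxQ, hx, _⟩ := exists_reg _ _ _ hc hc
      have h1 := exchange h (IsLocalRing.le_maximalIdeal Q.2.ne_top hxQ) hx
      have h2 := le_height_add_coheight Q h1 (height_succ hx hi)
        (sup_le hQ ((Ideal.span_singleton_le_iff_mem _).2 hxQ))
      push_cast
      rwa [add_comm (k : ℕ∞), ← add_assoc]
end Loc

/-- Regular sequences modulo an ideal, recursively. -/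
def RegSeq {R : Type*} [CommRing R] : Ideal R → List R → Prop
  | _, [] => True
  | L, x :: xs => Reg L x ∧ RegSeq (L ⊔ Ideal.span {x}) xs

theorem regSeq_of_forall {R : Type*} [CommRing R] : ∀ (rs : List R) (L : Ideal R)
    (_ : ∀ i (h : i < rs.length), Reg (L ⊔ Ideal.ofList (rs.take i)) rs[i]), RegSeq L rs
  | [], _, _ => trivial
  | x :: xs, L, h => by
    have h0 := h 0 (by simp)
    simp only [List.take_zero, Ideal.ofList_nil, sup_bot_eq] at h0
    refine ⟨h0, regSeq_of_forall xs _ fun i hi => ?_⟩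
    have := h (i + 1) (by simpa using hi)
    simpa [sup_assoc] using this

theorem regSeq_of_isWeaklyRegular {R : Type*} [CommRing R] (L : Ideal R) (rs : List R)
    (h : RingTheory.Sequence.IsWeaklyRegular (R ⧸ L) rs) : RegSeq L rs := by
  apply regSeq_of_forall
  intro i hi f hf
  have key : ∀ (T : Ideal R) (g : R),
      Submodule.Quotient.mk (p := (T • ⊤ : Submodule R (R ⧸ L))) (Submodule.mkQ L g) = 0 ↔
        g ∈ L ⊔ T := by
    intro T g
    rw [Submodule.Quotient.mk_eq_zero]
    have e : (T • ⊤ : Submodule R (R ⧸ L)) = Submodule.map (Submodule.mkQ L) T := by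
      have : (⊤ : Submodule R (R ⧸ L)) = Submodule.map (Submodule.mkQ L) ⊤ := by
        rw [Submodule.map_top, Submodule.range_mkQ]
      rw [this, ← Submodule.map_smul'']
      simp
    rw [e, ← Submodule.mem_comap, Submodule.comap_map_mkQ]
  rw [← key] at hf ⊢
  have h0 := h.regular_mod_prev i hi
  apply h0
  simp only [smul_zero]
  rw [← hf]
  rfl

section Localize
variable {R : Type*} [CommRing R] (m : Ideal R) [hm : m.IsPrime]

theorem reg_map {L : Ideal R} {x : R} (hx : Reg L x) :
    Reg (L.map (algebraMap R (Localization.AtPrime m))) (algebraMap R _ x) := by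
  intro f hf
  obtain ⟨a, s, rfl⟩ := IsLocalization.exists_mk'_eq m.primeCompl f
  rw [IsLocalization.mul_mk'_eq_mk'_of_mul,
    IsLocalization.mk'_mem_map_algebraMap_iff] at hf
  rw [IsLocalization.mk'_mem_map_algebraMap_iff]
  obtain ⟨t, ht, h⟩ := hf
  refine ⟨t, ht, hx _ ?_⟩
  rwa [mul_left_comm]

theorem map_le_max {L : Ideal R} (h : L ≤ m) :
    L.map (algebraMap R (Localization.AtPrime m)) ≤
      IsLocalRing.maximalIdeal (Localization.AtPrime m) := by
  rw [← Localization.AtPrime.map_eq_maximalIdeal]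
  exact Ideal.map_mono h

theorem RegSeq.depth : ∀ {rs : List R} {L : Ideal R} (_ : RegSeq L rs) (_ : ∀ f ∈ rs, f ∈ m)
    (_ : L ≤ m), DepthGE rs.length (L.map (algebraMap R (Localization.AtPrime m)))
  | [], _, _, _, h => map_le_max m h
  | x :: xs, L, h, hrs, hL => by
    have hx : x ∈ m := hrs x (by simp)
    refine ⟨algebraMap R _ x, map_le_max m le_rfl (Ideal.mem_map_of_mem _ hx), reg_map m h.1, ?_⟩
    have := RegSeq.depth h.2 (fun f hf => hrs f (by simp [hf]))
      (sup_le hL ((Ideal.span_singleton_le_iff_mem _).2 hx))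
    rwa [Ideal.map_sup, Ideal.map_span, Set.image_singleton] at this

theorem disj {P : Ideal R} (h : P ≤ m) : Disjoint (m.primeCompl : Set R) (P : Set R) := by
  rw [Set.disjoint_left]
  intro a ha ha'
  exact ha (h ha')

/-- The prime of the localization corresponding to `P ≤ m`. -/
noncomputable def locP (P : Ideal R) (hP : P.IsPrime) (h : P ≤ m) :
    PrimeSpectrum (Localization.AtPrime m) :=
  ⟨P.map (algebraMap R _), IsLocalization.isPrime_of_isPrime_disjoint m.primeCompl _ P hP
    (disj m h)⟩

theorem height_locP (P : Ideal R) (hP : P.IsPrime) (h : P ≤ m) :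
    Order.height (locP m P hP h) = Order.height (⟨P, hP⟩ : PrimeSpectrum R) := by
  rw [← PrimeSpectrum.height_eq_orderHeight, ← PrimeSpectrum.height_eq_orderHeight]
  exact IsLocalization.height_map_of_disjoint m.primeCompl P (disj m h)

theorem coheight_locP (P : Ideal R) (hP : P.IsPrime) (h : P ≤ m) :
    Order.coheight (locP m P hP h) ≤ Order.coheight (⟨P, hP⟩ : PrimeSpectrum R) := by
  have hmono : StrictMono
      (PrimeSpectrum.comap (algebraMap R (Localization.AtPrime m))) := by
    intro p q hpq
    exact (IsLocalization.orderEmbedding m.primeCompl (Localization.AtPrime m)).strictMono hpq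
  have := Order.coheight_le_coheight_apply_of_strictMono _ hmono (locP m P hP h)
  have e : PrimeSpectrum.comap (algebraMap R (Localization.AtPrime m)) (locP m P hP h) = ⟨P, hP⟩ :=
    PrimeSpectrum.ext (IsLocalization.under_map_of_isPrime_disjoint m.primeCompl
      (Localization.AtPrime m) hP (disj m h))
  rwa [e] at this

theorem assP_map {L P : Ideal R} (hP : AssP L P) (h : P ≤ m) :
    AssP (L.map (algebraMap R (Localization.AtPrime m)))
      (P.map (algebraMap R (Localization.AtPrime m))) := by
  refine ⟨(locP m P hP.1 h).2, ?_⟩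
  obtain ⟨f, hf⟩ := hP.2
  refine ⟨algebraMap R _ f, fun a => ?_⟩
  obtain ⟨a, s, rfl⟩ := IsLocalization.exists_mk'_eq m.primeCompl a
  rw [mul_comm, IsLocalization.mul_mk'_eq_mk'_of_mul,
    IsLocalization.mk'_mem_map_algebraMap_iff, IsLocalization.mk'_mem_map_algebraMap_iff]
  simp only [hf]
  refine exists_congr fun t => and_congr_right fun _ => ?_
  rw [mul_assoc, mul_comm a f]

theorem coheight_le_dim (I Q : Ideal R) (hQ : Q.IsPrime) (h : I ≤ Q) :
    (Order.coheight (⟨Q, hQ⟩ : PrimeSpectrum R) : WithBot ℕ∞) ≤ ringKrullDim (R ⧸ I) := by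
  rw [Order.coheight_eq_krullDim_Ici, ringKrullDim_quotient]
  refine Order.krullDim_le_of_strictMono
    (fun p => ⟨p.1, ?_⟩) (fun p q hpq => hpq)
  exact fun a ha => p.2 (h ha)

theorem core [IsNoetherianRing R] {xs rs : List R} (hR : ringKrullDim R ≤ (xs.length : ℕ∞))
    (hxs : ∀ f ∈ xs, f ∈ m) (hreg : RegSeq ⊥ xs)
    {I : Ideal R} (hrs : ∀ f ∈ rs, f ∈ m) (hIreg : RegSeq I rs)
    (hdim : ringKrullDim (R ⧸ I) = (rs.length : ℕ∞))
    {A : R} (hAm : A ∈ m) (hA : Reg I A)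
    {Q : Ideal R} (hQ : Q.IsPrime) (hIQ : I ≤ Q) (hQm : Q ≤ m)
    {P : Ideal R} (hP : AssP (I ⊔ Ideal.span {A}) P) (hPm : P ≤ m) :
    Order.height (⟨P, hP.1⟩ : PrimeSpectrum R) ≤
      Order.height (⟨Q, hQ⟩ : PrimeSpectrum R) + 1 := by
  have hS := hreg.depth m hxs bot_le
  rw [Ideal.map_bot] at hS
  have h1 := le_height_add_coheight (locP m Q hQ hQm) (i := 0) hS (fun _ _ => zero_le) bot_le
  rw [height_locP, zero_add] at h1
  have h2 := coheight_locP m Q hQ hQm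
  have h3 : Order.coheight (⟨Q, hQ⟩ : PrimeSpectrum R) ≤ (rs.length : ℕ∞) := by
    have := coheight_le_dim I Q hQ hIQ
    rw [hdim] at this
    exact WithBot.coe_le_coe.1 this
  have h4 : Order.height (⟨P, hP.1⟩ : PrimeSpectrum R) + Order.coheight (⟨P, hP.1⟩ : PrimeSpectrum R)
      ≤ (xs.length : ℕ∞) := by
    have : Nonempty (PrimeSpectrum R) := ⟨⟨P, hP.1⟩⟩
    have h5 : Order.krullDim (PrimeSpectrum R) ≤ (xs.length : ℕ∞) := hR
    rw [Order.krullDim_eq_iSup_height_add_coheight_of_nonempty] at h5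
    exact (le_iSup (fun a : PrimeSpectrum R => Order.height a + Order.coheight a) _).trans
      (WithBot.coe_le_coe.1 h5)
  have h6 : (xs.length : ℕ∞) ≤ Order.height (⟨Q, hQ⟩ : PrimeSpectrum R) + rs.length :=
    h1.trans (add_le_add_right (h2.trans h3) _)
  have hI := hIreg.depth m hrs (hIQ.trans hQm)
  rcases hn : rs.length with _ | k
  · rw [hn] at h6
    exact ((le_self_add.trans h4).trans h6).trans (by simp)
  · rw [hn] at hI h6
    have h7 := exchange hI (map_le_max m le_rfl (Ideal.mem_map_of_mem _ hAm)) (reg_map m hA)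
    have h8 := assP_map m hP hPm
    rw [Ideal.map_sup, Ideal.map_span, Set.image_singleton] at h8
    have h9 := (depth_le_coheight h7 h8).trans (coheight_locP m P hP.1 hPm)
    have h10 := ((add_le_add_right h9 _).trans h4).trans h6
    push_cast at h10
    rw [add_comm (k : ℕ∞), ← add_assoc] at h10
    exact (ENat.add_le_add_iff_right (ENat.natCast_ne_top k)).1 h10

end Localize

section Poly
variable {K : Type} [Field K] {n : ℕ}

theorem mem_vars_iff {σ : Type*} (p : MvPolynomial σ K) :
    p ∈ idealOfVars σ K ↔ coeff 0 p = 0 := by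
  rw [← pow_one (idealOfVars σ K), mem_pow_idealOfVars_iff']
  constructor
  · intro h
    exact h 0 (by simp)
  · intro h x hx
    have : x = 0 := by
      rw [← Finsupp.degree_eq_zero_iff]
      omega
    rw [this, h]

theorem vars_isPrime {σ : Type*} : (idealOfVars σ K).IsPrime := by
  have : idealOfVars σ K = RingHom.ker (constantCoeff : MvPolynomial σ K →+* K) := by
    ext p
    rw [mem_vars_iff, RingHom.mem_ker, constantCoeff_eq]
  rw [this]
  exact RingHom.ker_isPrime _

theorem mem_of_forall_pow {L : Ideal (MvPolynomial (Fin n) K)} (hL : IsHomogeneousIdeal L)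
    {f : MvPolynomial (Fin n) K} (h : ∀ k, f ∈ L ⊔ (idealOfVars (Fin n) K) ^ k) : f ∈ L := by
  rw [← sum_homogeneousComponent f]
  refine L.sum_mem fun j _ => ?_
  obtain ⟨l, hl, g, hg, rfl⟩ := Submodule.mem_sup.1 (h (j + 1))
  have : homogeneousComponent j g = 0 := by
    ext e
    rw [coeff_homogeneousComponent, coeff_zero]
    split_ifs with he
    · exact (mem_pow_idealOfVars_iff' _ _).1 hg e (by omega)
    · rfl
  rw [map_add, this, add_zero]
  exact hL l hl j

theorem reg_of_not_mem {L : Ideal (MvPolynomial (Fin n) K)} (hL : IsHomogeneousIdeal L)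
    {p : MvPolynomial (Fin n) K} (hp : p ∉ idealOfVars (Fin n) K) : Reg L p := by
  intro f hf
  rw [mem_vars_iff] at hp
  set c := coeff 0 p with hc
  -- `f = q f + (element of L)` with `q` in the irrelevant ideal
  have hq : 1 - C c⁻¹ * p ∈ idealOfVars (Fin n) K := by
    rw [mem_vars_iff]
    simp [← hc, hp]
  apply mem_of_forall_pow hL
  have hk : ∀ k, f - (1 - C c⁻¹ * p) ^ k * f ∈ L := by
    intro k
    induction k with
    | zero => simp
    | succ k ih =>
      have e : f - (1 - C c⁻¹ * p) ^ (k + 1) * f =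
        (f - (1 - C c⁻¹ * p) ^ k * f) + ((1 - C c⁻¹ * p) ^ k * C c⁻¹) * (p * f) := by ring
      rw [e]
      exact L.add_mem ih (L.mul_mem_left _ hf)
  intro k
  have e : f = (f - (1 - C c⁻¹ * p) ^ k * f) + (1 - C c⁻¹ * p) ^ k * f := by ring
  rw [e]
  exact Submodule.add_mem_sup (hk k) (Ideal.mul_mem_right _ _ (Ideal.pow_mem_pow hq k))

theorem AssP.le_vars {L P : Ideal (MvPolynomial (Fin n) K)} (hL : IsHomogeneousIdeal L)
    (hP : AssP L P) : P ≤ idealOfVars (Fin n) K := by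
  intro p hp
  by_contra h
  exact hP.reg_not_mem (reg_of_not_mem hL h) hp

theorem homog_sup {I : Ideal (MvPolynomial (Fin n) K)} (hI : IsHomogeneousIdeal I) {d : ℕ}
    {A : MvPolynomial (Fin n) K} (hA : A ∈ homogeneousSubmodule (Fin n) K d) :
    IsHomogeneousIdeal (I ⊔ Ideal.span {A}) := by
  letI : GradedAlgebra (homogeneousSubmodule (Fin n) K) := MvPolynomial.gradedAlgebra
  have h1 : I.IsHomogeneous (homogeneousSubmodule (Fin n) K) := by
    intro i f hf
    have := hI f hf i
    rwa [← decomposition.decompose'_apply] at this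
  have h2 : (Ideal.span {A}).IsHomogeneous (homogeneousSubmodule (Fin n) K) := by
    apply Ideal.homogeneous_span
    rintro x rfl
    exact ⟨d, hA⟩
  intro p hp k
  exact homogeneousComponent_mem_of_mem (h1.sup h2) hp k

theorem regSeq_vars : RegSeq (⊥ : Ideal (MvPolynomial (Fin n) K)) (List.ofFn X) := by
  apply regSeq_of_forall
  intro i hi
  simp only [List.length_ofFn] at hi
  have e : Ideal.ofList ((List.ofFn (X : Fin n → MvPolynomial (Fin n) K)).take i) =
      Ideal.span (X '' {j : Fin n | (j : ℕ) < i}) := by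
    unfold Ideal.ofList
    congr 1
    ext p
    simp only [Set.mem_ofPred_eq, Set.mem_image, List.mem_take_iff_getElem, List.getElem_ofFn,
      List.length_ofFn]
    constructor
    · rintro ⟨j, hj, rfl⟩
      exact ⟨⟨j, by omega⟩, by simp; omega, rfl⟩
    · rintro ⟨j, hj, rfl⟩
      exact ⟨j, by have := j.2; omega, rfl⟩
  rw [bot_sup_eq, e, List.getElem_ofFn]
  intro f hf
  rw [mem_ideal_span_X_image] at hf ⊢
  intro a ha
  obtain ⟨j, hj, h⟩ := hf (Finsupp.single ⟨i, hi⟩ 1 + a) (by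
    rw [mem_support_iff, coeff_X_mul]
    exact mem_support_iff.1 ha)
  refine ⟨j, hj, ?_⟩
  have hne : (⟨i, hi⟩ : Fin n) ≠ j := by
    rintro rfl
    simp at hj
  simpa [Finsupp.single_apply, hne] using h

theorem idealHeight_prime {R : Type} [CommRing R] {P : Ideal R} (hP : P.IsPrime) :
    idealHeight P = Order.height (⟨P, hP⟩ : PrimeSpectrum R) := by
  unfold idealHeight
  apply le_antisymm
  · exact iInf₂_le_of_le ⟨P, hP⟩ le_rfl le_rfl
  · exact le_iInf₂ fun Q hQ => Order.height_mono (show (⟨P, hP⟩ : PrimeSpectrum R) ≤ Q from hQ)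

/-- The height of a proper ideal is attained at a minimal prime. -/
theorem exists_minimal_height {R : Type} [CommRing R] {I : Ideal R} (hI : I ≠ ⊤) :
    ∃ Q, ∃ hQ : Q ∈ I.minimalPrimes,
      Order.height (⟨Q, hQ.1.1⟩ : PrimeSpectrum R) = idealHeight I := by
  obtain ⟨M, hM, hIM⟩ := Ideal.exists_le_maximal I hI
  have : Nonempty {P : PrimeSpectrum R // I ≤ P.asIdeal} := ⟨⟨⟨M, hM.isPrime⟩, hIM⟩⟩
  obtain ⟨⟨Q, hQ⟩, e⟩ := ENat.exists_eq_iInf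
    (fun P : {P : PrimeSpectrum R // I ≤ P.asIdeal} => Order.height P.1)
  obtain ⟨Q₀, hQ₀, hle⟩ := Ideal.exists_minimalPrimes_le hQ
  refine ⟨Q₀, hQ₀, le_antisymm ?_ ?_⟩
  · have h1 : Order.height (⟨Q₀, hQ₀.1.1⟩ : PrimeSpectrum R) ≤ Order.height Q :=
      Order.height_mono hle
    refine h1.trans (le_of_eq ?_)
    rw [idealHeight, iInf_subtype']
    exact e
  · exact iInf₂_le_of_le ⟨Q₀, hQ₀.1.1⟩ hQ₀.1.2 le_rfl

end Poly

/-- Associated primes of `I + A J` are associated to `J` or to `I + (A)`. -/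
theorem assP_split {R : Type*} [CommRing R] {I J P : Ideal R} {A : R} (hIJ : I ≤ J)
    (hA : Reg I A) (hP : AssP (I ⊔ Ideal.span {A} * J) P) :
    AssP J P ∨ AssP (I ⊔ Ideal.span {A}) P := by
  obtain ⟨hp, f, hf⟩ := hP
  by_cases hc : ∃ a, a ∉ P ∧ a * f ∈ I ⊔ Ideal.span {A}
  · left
    obtain ⟨a, haP, ha⟩ := hc
    obtain ⟨l, hl, h, e⟩ := mem_sup_span.1 ha
    refine ⟨hp, h, fun b => ?_⟩
    have h1 : b ∈ P ↔ b * a ∈ P :=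
      ⟨fun hb => P.mul_mem_right _ hb, fun hb => (hp.mem_or_mem hb).resolve_right haP⟩
    have h2 : b * a * f = b * l + A * (b * h) := by linear_combination b * e
    rw [h1, hf, h2]
    constructor
    · intro hmem
      obtain ⟨i, hi, y, hy, ey⟩ := Submodule.mem_sup.1 hmem
      obtain ⟨j, hj, rfl⟩ := Ideal.mem_span_singleton_mul.1 hy
      have : b * h - j ∈ I := hA _ (by
        have : A * (b * h - j) = i - b * l := by linear_combination -ey
        rw [this]
        exact I.sub_mem hi (I.mul_mem_left _ hl))
      have := J.add_mem (hIJ this) hj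
      rwa [sub_add_cancel] at this
    · intro hmem
      exact Submodule.add_mem_sup (I.mul_mem_left _ hl)
        (Ideal.mul_mem_mul (Ideal.mem_span_singleton_self A) hmem)
  · right
    push Not at hc
    refine ⟨hp, f, fun a => ⟨fun ha => ?_, fun ha => ?_⟩⟩
    · have hle : I ⊔ Ideal.span {A} * J ≤ I ⊔ Ideal.span {A} :=
        sup_le_sup_left (Ideal.mul_le_left (I := Ideal.span {A}) (J := J)) I
      exact hle ((hf a).1 ha)
    · by_contra haP
      exact hc a haP ha

end BDL

/-- if `I` is perfect (i.e. `R/I` is Cohen-Macaulay), `J ⊇ I` is unmixed of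
codimension one more, and `I : A = I`, then `I + A·J` is unmixed. -/
theorem basic_double_link_unmixed {K : Type} [Field K] {n : ℕ}
    (I J : Ideal (MvPolynomial (Fin (n + 1)) K))
    (hI : IsHomogeneousIdeal I) (hJ : IsHomogeneousIdeal J) (hIJ : I ≤ J)
    (hperf : IsCMQuotient I) (hunm : IsUnmixed J)
    (hht : idealHeight J = idealHeight I + 1)
    (d : ℕ) (A : MvPolynomial (Fin (n + 1)) K)
    (hA : A ∈ homogeneousSubmodule (Fin (n + 1)) K d)
    (hcol : I.colon (Ideal.span {A}) = I) :
    IsUnmixed (I ⊔ Ideal.span {A} * J) := by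
  obtain ⟨rs, hrs, hreg, hlen⟩ := hperf
  have hItop : I ≠ ⊤ := by
    have := hreg.nontrivial
    exact Ideal.Quotient.nontrivial_iff.1 this
  have hAreg : BDL.Reg I A := by
    intro f hf
    rw [← hcol, Submodule.mem_colon]
    intro y hy
    obtain ⟨g, rfl⟩ := Ideal.mem_span_singleton'.1 hy
    have : f • (g * A) = g * (A * f) := by simp only [smul_eq_mul]; ring
    rw [this]
    exact I.mul_mem_left _ hf
  obtain ⟨Q, hQ, hQht⟩ := BDL.exists_minimal_height hItop
  have hQm := (BDL.assP_of_minimal hQ).le_vars hI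
  have : (idealOfVars (Fin (n + 1)) K).IsPrime := BDL.vars_isPrime
  -- associated primes of `I + (A)` have the right height
  have hIA : ∀ P, BDL.AssP (I ⊔ Ideal.span {A}) P → idealHeight P = idealHeight I + 1 := by
    intro P hP
    have hPm := hP.le_vars (BDL.homog_sup hI hA)
    have hAP : A ∈ P := hP.le (le_sup_right (a := I) (Ideal.mem_span_singleton_self A))
    rw [BDL.idealHeight_prime hP.1]
    apply le_antisymm
    · rw [← hQht]
      refine BDL.core (idealOfVars (Fin (n + 1)) K) (xs := List.ofFn X) (rs := rs) ?_ ?_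
        BDL.regSeq_vars hrs (BDL.regSeq_of_isWeaklyRegular _ _ hreg.toIsWeaklyRegular) hlen.symm
        (hPm hAP) hAreg hQ.1.1 hQ.1.2 hQm hP hPm
      · rw [MvPolynomial.ringKrullDim_of_isNoetherianRing, ringKrullDim_eq_zero_of_field]
        simp
      · intro f hf
        obtain ⟨i, rfl⟩ := List.mem_ofFn.1 hf
        exact Ideal.subset_span ⟨i, rfl⟩
    · exact BDL.height_succ hAreg (fun P' hP' => iInf₂_le_of_le P' hP' le_rfl) ⟨P, hP.1⟩ hP.le
  have hall : ∀ P, BDL.AssP (I ⊔ Ideal.span {A} * J) P → idealHeight P = idealHeight I + 1 := by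
    intro P hP
    rcases BDL.assP_split hIJ hAreg hP with h | h
    · rw [hunm P (BDL.assP_iff.1 h), hht]
    · exact hIA P h
  intro P hP
  have hP' := BDL.assP_iff.2 hP
  have hLtop : I ⊔ Ideal.span {A} * J ≠ ⊤ := by
    intro h
    exact hP'.1.ne_top (top_le_iff.1 (h ▸ hP'.le))
  obtain ⟨Q', hQ', hQ'ht⟩ := BDL.exists_minimal_height hLtop
  rw [hall P hP', ← hQ'ht, ← BDL.idealHeight_prime, hall Q' (BDL.assP_of_minimal hQ')]
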